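/- (Energy–discrepancy identity) Let ε > 0, let u_ε be a solution of the vectorial Allen–Cahn system on Ω, and let x₀ ∈ Ω. Then for every r with 0 < r < dist(x₀,∂Ω), the function r ↦ E_ε(u_ε, D(x₀,r))/r is differentiable and its derivative equals (1/r²)·∫_{D(x₀,r)} ξ_ε(u_ε) dx + (1/r)·∫_{∂D(x₀,r)} ε|∂u_ε/∂ν|² dℓ, where ξ_ε(u) = ε⁻¹V(u) − (ε/2)|∇u|² is the discrepancy function, ∂/∂ν is the outward normal (radial) derivative on ∂D(x₀,r), and dℓ is arclength. -/

import Mathlib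

open MeasureTheory Metric Filter Topology Bornology
open scoped RealInnerProductSpace ENNReal Topology

noncomputable section

/-- The euclidean plane. -/
abbrev E2 : Type := EuclideanSpace ℝ (Fin 2)

/-- The euclidean space `ℝ^k`. -/
abbrev Evec (k : ℕ) : Type := EuclideanSpace ℝ (Fin k)

/-- The `i`-th standard basis vector of the plane. -/
def b2 (i : Fin 2) : E2 := EuclideanSpace.single i (1 : ℝ)

/-- The partial derivative of `u` in the `i`-th coordinate direction. -/
def pder {k : ℕ} (u : E2 → Evec k) (i : Fin 2) (x : E2) : Evec k :=
  fderiv ℝ u x (b2 i)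

/-- The Laplacian of a map defined on the plane. -/
def lap {k : ℕ} (u : E2 → Evec k) (x : E2) : Evec k :=
  ∑ i : Fin 2, fderiv ℝ (pder u i) x (b2 i)

/-- `u` is a smooth solution of the vectorial Allen-Cahn system
`Δu = ε⁻² ∇V(u)` on the open set `U`. -/
def IsSolution {k : ℕ} (V : Evec k → ℝ) (ε : ℝ) (U : Set E2) (u : E2 → Evec k) : Prop :=
  ContDiffOn ℝ (⊤ : ℕ∞) u U ∧ ∀ x ∈ U, lap u x = (ε ^ 2)⁻¹ • gradient V (u x)

/-- The squared modulus `|∇u|²` of the full gradient. -/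
def gradSq {k : ℕ} (u : E2 → Evec k) (x : E2) : ℝ :=
  ∑ i : Fin 2, ‖pder u i x‖ ^ 2

/-- The energy density `e_ε(u) = (ε/2)|∇u|² + ε⁻¹ V(u)`. -/
def eDens {k : ℕ} (V : Evec k → ℝ) (ε : ℝ) (u : E2 → Evec k) (x : E2) : ℝ :=
  ε / 2 * gradSq u x + ε⁻¹ * V (u x)

/-- The energy `E_ε(u, G)`. -/
def energy {k : ℕ} (V : Evec k → ℝ) (ε : ℝ) (u : E2 → Evec k) (G : Set E2) : ℝ :=
  ∫ x in G, eDens V ε u x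

/-- The hypotheses (H₁), (H₂), (H₃) on the multi-well potential `V`:
smooth, nonnegative with `inf V = 0`, finitely many zeros (at least two),
positive definite Hessian at each zero, quadratic growth of `y·∇V(y)` at
infinity and coercivity. -/
structure IsMultiWell {k : ℕ} (V : Evec k → ℝ) : Prop where
  smooth : ContDiff ℝ (⊤ : ℕ∞) V
  nonneg : ∀ y, 0 ≤ V y
  finite_zeros : {y : Evec k | V y = 0}.Finite
  two_le_card : 2 ≤ {y : Evec k | V y = 0}.ncard
  hess_posdef : ∀ σ : Evec k, V σ = 0 → ∀ w : Evec k, w ≠ 0 →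
    0 < iteratedFDeriv ℝ 2 V σ ![w, w]
  growth : ∃ α > (0 : ℝ), ∃ R > (0 : ℝ), ∀ y : Evec k, R < ‖y‖ →
    α * ‖y‖ ^ 2 ≤ ⟪y, gradient V y⟫
  coercive : ∀ C : ℝ, ∃ R : ℝ, ∀ y : Evec k, R ≤ ‖y‖ → C ≤ V y

/-- The point of the plane with coordinates `(a, b)`. -/
def vec2 (a b : ℝ) : E2 :=
  EuclideanSpace.single (0 : Fin 2) a + EuclideanSpace.single (1 : Fin 2) b

/-- The point of the circle of center `x₀` and radius `r` at angle `θ`. -/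
def circPt (x₀ : E2) (r θ : ℝ) : E2 := x₀ + vec2 (r * Real.cos θ) (r * Real.sin θ)

/-- The outward unit normal vector of a circle at angle `θ`. -/
def norv (θ : ℝ) : E2 := vec2 (Real.cos θ) (Real.sin θ)

/-- The unit tangent vector of a circle at angle `θ`. -/
def tanv (θ : ℝ) : E2 := vec2 (-Real.sin θ) (Real.cos θ)

lemma vec2_eq (a b : ℝ) : vec2 a b = a • b2 0 + b • b2 1 := by
  ext i
  fin_cases i <;> simp [vec2, b2]

lemma norv_eq (θ : ℝ) : norv θ = Real.cos θ • b2 0 + Real.sin θ • b2 1 := vec2_eq _ _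

lemma circPt_eq (x₀ : E2) (r θ : ℝ) : circPt x₀ r θ = x₀ + r • norv θ := by
  simp only [circPt, norv, vec2_eq, smul_add, smul_smul]

lemma continuous_circPt (x₀ : E2) : Continuous fun p : ℝ × ℝ => circPt x₀ p.1 p.2 := by
  simp only [circPt, vec2_eq]
  fun_prop

lemma contDiff_circPt (x₀ : E2) {n : ℕ∞} :
    ContDiff ℝ n fun p : ℝ × ℝ => circPt x₀ p.1 p.2 := by
  simp only [circPt, vec2_eq]
  fun_prop

lemma dist_circPt (x₀ : E2) (r θ : ℝ) : dist (circPt x₀ r θ) x₀ = |r| := by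
  rw [dist_eq_norm, circPt, add_sub_cancel_left, EuclideanSpace.norm_eq]
  rw [← Real.sqrt_sq_eq_abs]
  congr 1
  simp [vec2, Fin.sum_univ_two]
  linear_combination r ^ 2 * Real.sin_sq_add_cos_sq θ

lemma hasDerivAt_circPt_radius (x₀ : E2) (r θ : ℝ) :
    HasDerivAt (fun s => circPt x₀ s θ) (norv θ) r := by
  simp only [circPt_eq]
  simpa using ((hasDerivAt_id r).smul_const (norv θ)).const_add x₀

lemma hasDerivAt_circPt_angle (x₀ : E2) (r θ : ℝ) :
    HasDerivAt (fun t => circPt x₀ r t) (r • tanv θ) θ := by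
  simp only [circPt, tanv, vec2_eq, smul_add, smul_smul]
  exact ((((Real.hasDerivAt_cos θ).const_mul r).smul_const _).add
    (((Real.hasDerivAt_sin θ).const_mul r).smul_const _)).const_add x₀

/-- Integration over the plane in cartesian coordinates centered at `x₀`. -/
lemma integral_vec2 (x₀ : E2) (f : E2 → ℝ) :
    ∫ p : ℝ × ℝ, f (x₀ + vec2 p.1 p.2) = ∫ x, f x := by
  have h1 := (volume_preserving_finTwoArrow ℝ).symm
  have h2 := (EuclideanSpace.volume_preserving_symm_measurableEquiv_toLp (Fin 2)).symm
  have h3 := (h1.trans h2).integral_comp' (g := fun x => f (x₀ + x))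
  rw [integral_add_left_eq_self f x₀] at h3
  rw [← h3]
  congr 1
  ext p
  congr 2
  ext i
  fin_cases i <;> simp [vec2, MeasurableEquiv.finTwoArrow]

/-- Integration over a disk in polar coordinates. -/
lemma integral_ball_eq_polar (x₀ : E2) {f : E2 → ℝ} (hf : Continuous f) {s : ℝ} (hs : 0 ≤ s) :
    ∫ x in ball x₀ s, f x =
      ∫ ρ in (0 : ℝ)..s, ρ * ∫ θ in (0 : ℝ)..(2 * Real.pi), f (circPt x₀ ρ θ) := by
  have hper : ∀ ρ, ∫ θ in (0 : ℝ)..(2 * Real.pi), f (circPt x₀ ρ θ) =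
      ∫ θ in Set.Ioo (-Real.pi) Real.pi, f (circPt x₀ ρ θ) := by
    intro ρ
    have hp : Function.Periodic (fun θ => f (circPt x₀ ρ θ)) (2 * Real.pi) := by
      intro θ
      simp [circPt]
    have := hp.intervalIntegral_add_eq 0 (-Real.pi)
    rw [zero_add, show -Real.pi + 2 * Real.pi = Real.pi by ring] at this
    rw [this, intervalIntegral.integral_of_le (by linarith [Real.pi_pos]),
      integral_Ioc_eq_integral_Ioo]
  simp only [hper]
  rw [intervalIntegral.integral_of_le hs, integral_Ioc_eq_integral_Ioo]
  simp only [← integral_const_mul]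
  have hc : Continuous fun p : ℝ × ℝ => p.1 * f (circPt x₀ p.1 p.2) :=
    continuous_fst.mul (hf.comp (continuous_circPt x₀))
  have hint : IntegrableOn (fun p : ℝ × ℝ => p.1 * f (circPt x₀ p.1 p.2))
      (Set.Ioo 0 s ×ˢ Set.Ioo (-Real.pi) Real.pi) (volume.prod volume) :=
    (hc.continuousOn.integrableOn_compact
      ((isCompact_Icc (a := (0 : ℝ)) (b := s)).prod
        (isCompact_Icc (a := -Real.pi) (b := Real.pi)))).mono_set
      (Set.prod_mono Set.Ioo_subset_Icc_self Set.Ioo_subset_Icc_self)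
  rw [← setIntegral_prod _ hint, ← integral_indicator measurableSet_ball, ← integral_vec2 x₀,
    ← integral_comp_polarCoord_symm]
  have hsub : Set.Ioo 0 s ×ˢ Set.Ioo (-Real.pi) Real.pi ⊆ polarCoord.target :=
    Set.prod_mono Set.Ioo_subset_Ioi_self subset_rfl
  have htarget : MeasurableSet polarCoord.target := measurableSet_Ioi.prod measurableSet_Ioo
  rw [← integral_indicator (measurableSet_Ioo.prod measurableSet_Ioo),
    ← integral_indicator htarget, Measure.volume_eq_prod]
  congr 1
  ext ⟨ρ, θ⟩
  by_cases hp : (ρ, θ) ∈ polarCoord.target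
  · rw [Set.indicator_of_mem hp]
    have h0 : 0 < ρ := hp.1
    change ρ * (ball x₀ s).indicator f (circPt x₀ ρ θ) = _
    by_cases hρ : ρ < s
    · rw [Set.indicator_of_mem, Set.indicator_of_mem]
      · exact ⟨⟨h0, hρ⟩, hp.2⟩
      · rw [mem_ball, dist_circPt, abs_of_pos h0]
        exact hρ
    · rw [Set.indicator_of_notMem, Set.indicator_of_notMem, mul_zero]
      · exact fun h => hρ h.1.2
      · rw [mem_ball, dist_circPt, abs_of_pos h0]
        exact hρ
  · rw [Set.indicator_of_notMem hp, Set.indicator_of_notMem fun h => hp (hsub h)]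

lemma continuous_circle_integral (x₀ : E2) {f : E2 → ℝ} (hf : Continuous f) :
    Continuous fun ρ : ℝ => ρ * ∫ θ in (0 : ℝ)..(2 * Real.pi), f (circPt x₀ ρ θ) := by
  refine continuous_id.mul ?_
  refine intervalIntegral.continuous_parametric_intervalIntegral_of_continuous' ?_ _ _
  exact hf.comp (continuous_circPt x₀)

/-- The derivative of the integral over a disk, in the radius, is the integral over the circle. -/
lemma hasDerivAt_integral_ball (x₀ : E2) {f : E2 → ℝ} (hf : Continuous f) {r : ℝ} (hr : 0 < r) :
    HasDerivAt (fun s => ∫ x in ball x₀ s, f x)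
      (r * ∫ θ in (0 : ℝ)..(2 * Real.pi), f (circPt x₀ r θ)) r := by
  have hc := continuous_circle_integral x₀ hf
  refine (intervalIntegral.integral_hasDerivAt_right (a := 0) (hc.intervalIntegrable _ _)
    (hc.stronglyMeasurableAtFilter _ _) hc.continuousAt).congr_of_eventuallyEq ?_
  filter_upwards [lt_mem_nhds hr] with s hs
  exact integral_ball_eq_polar x₀ hf hs.le

/-- The divergence theorem on a disk, for the vector field with components `P` and `Q`. -/
lemma integral_divergence_ball (x₀ : E2) {P Q : E2 → ℝ} (hP : ContDiff ℝ 1 P)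
    (hQ : ContDiff ℝ 1 Q) {r : ℝ} (hr : 0 ≤ r) :
    ∫ x in ball x₀ r, (fderiv ℝ P x (b2 0) + fderiv ℝ Q x (b2 1)) =
      r * ∫ θ in (0 : ℝ)..(2 * Real.pi),
        (P (circPt x₀ r θ) * Real.cos θ + Q (circPt x₀ r θ) * Real.sin θ) := by
  have hcP : Continuous fun x => fderiv ℝ P x (b2 0) :=
    (hP.continuous_fderiv (by simp)).clm_apply continuous_const
  have hcQ : Continuous fun x => fderiv ℝ Q x (b2 1) :=
    (hQ.continuous_fderiv (by simp)).clm_apply continuous_const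
  have hcirc := contDiff_circPt x₀ (n := 1)
  have hP' : ContDiff ℝ 1 fun p : ℝ × ℝ => P (circPt x₀ p.1 p.2) := hP.comp hcirc
  have hQ' : ContDiff ℝ 1 fun p : ℝ × ℝ => Q (circPt x₀ p.1 p.2) := hQ.comp hcirc
  rw [integral_ball_eq_polar x₀
    (f := fun x => fderiv ℝ P x (b2 0) + fderiv ℝ Q x (b2 1)) (hcP.add hcQ) hr]
  let f : ℝ × ℝ → ℝ := fun p => p.1 *
    (P (circPt x₀ p.1 p.2) * Real.cos p.2 + Q (circPt x₀ p.1 p.2) * Real.sin p.2)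
  let g : ℝ × ℝ → ℝ := fun p =>
    -(P (circPt x₀ p.1 p.2) * Real.sin p.2) + Q (circPt x₀ p.1 p.2) * Real.cos p.2
  have hf : ContDiff ℝ 1 f := by fun_prop
  have hg : ContDiff ℝ 1 g := by fun_prop
  have hdf : Differentiable ℝ f := hf.differentiable (by simp)
  have hdg : Differentiable ℝ g := hg.differentiable (by simp)
  have hdiv : ∀ ρ θ : ℝ, fderiv ℝ f (ρ, θ) (1, 0) + fderiv ℝ g (ρ, θ) (0, 1) =
      ρ * (fderiv ℝ P (circPt x₀ ρ θ) (b2 0) + fderiv ℝ Q (circPt x₀ ρ θ) (b2 1)) := by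
    intro ρ θ
    have hPd := (hP.differentiable (by simp) (circPt x₀ ρ θ)).hasFDerivAt
    have hQd := (hQ.differentiable (by simp) (circPt x₀ ρ θ)).hasFDerivAt
    have hf1 : HasDerivAt (f ∘ fun s => (s, θ)) (fderiv ℝ f (ρ, θ) (1, 0)) ρ :=
      (hdf (ρ, θ)).hasFDerivAt.comp_hasDerivAt ρ
        ((hasDerivAt_id ρ).prodMk (hasDerivAt_const ρ θ))
    have hg1 : HasDerivAt (g ∘ fun t => (ρ, t)) (fderiv ℝ g (ρ, θ) (0, 1)) θ :=
      (hdg (ρ, θ)).hasFDerivAt.comp_hasDerivAt θ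
        ((hasDerivAt_const θ ρ).prodMk (hasDerivAt_id θ))
    have hPr := hPd.comp_hasDerivAt ρ (hasDerivAt_circPt_radius x₀ ρ θ)
    have hQr := hQd.comp_hasDerivAt ρ (hasDerivAt_circPt_radius x₀ ρ θ)
    have hPt := hPd.comp_hasDerivAt θ (hasDerivAt_circPt_angle x₀ ρ θ)
    have hQt := hQd.comp_hasDerivAt θ (hasDerivAt_circPt_angle x₀ ρ θ)
    have hf2 := (hasDerivAt_id ρ).mul
      ((hPr.mul_const (Real.cos θ)).add (hQr.mul_const (Real.sin θ)))
    have hg2 := (hPt.mul (Real.hasDerivAt_sin θ)).neg.add (hQt.mul (Real.hasDerivAt_cos θ))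
    rw [hf1.unique hf2, hg1.unique hg2]
    simp only [norv, tanv, vec2_eq, map_add, map_smul, smul_eq_mul, id, Function.comp,
      Pi.add_apply]
    linear_combination ρ * (fderiv ℝ P (circPt x₀ ρ θ) (b2 0) +
      fderiv ℝ Q (circPt x₀ ρ θ) (b2 1)) * Real.sin_sq_add_cos_sq θ
  have hcont : Continuous fun p : ℝ × ℝ => fderiv ℝ f p (1, 0) + fderiv ℝ g p (0, 1) :=
    ((hf.continuous_fderiv (by simp)).clm_apply continuous_const).add
      ((hg.continuous_fderiv (by simp)).clm_apply continuous_const)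
  have key := integral2_divergence_prod_of_hasFDerivAt_off_countable f g (fderiv ℝ f)
    (fderiv ℝ g) 0 0 r (2 * Real.pi) ∅ Set.countable_empty hf.continuous.continuousOn
    hg.continuous.continuousOn (fun p _ => (hdf p).hasFDerivAt) (fun p _ => (hdg p).hasFDerivAt)
    (hcont.continuousOn.integrableOn_compact (isCompact_uIcc.prod isCompact_uIcc))
  simp only [hdiv, intervalIntegral.integral_const_mul] at key
  rw [key]
  simp [f, g, circPt]

lemma contDiff_pder {k : ℕ} {u : E2 → Evec k} (hu : ContDiff ℝ (⊤ : ℕ∞) u) (i : Fin 2) :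
    ContDiff ℝ (⊤ : ℕ∞) (pder u i) :=
  (hu.fderiv_right (by simp)).clm_apply contDiff_const

lemma contDiff_gradSq {k : ℕ} {u : E2 → Evec k} (hu : ContDiff ℝ (⊤ : ℕ∞) u) :
    ContDiff ℝ (⊤ : ℕ∞) (gradSq u) :=
  ContDiff.sum fun i _ => (contDiff_pder hu i).norm_sq ℝ

lemma fderiv_pder_comm {k : ℕ} {u : E2 → Evec k} (hu : ContDiff ℝ (⊤ : ℕ∞) u) (x : E2)
    (i j : Fin 2) : fderiv ℝ (pder u i) x (b2 j) = fderiv ℝ (pder u j) x (b2 i) := by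
  have hd : DifferentiableAt ℝ (fderiv ℝ u) x :=
    (hu.fderiv_right (m := (⊤ : ℕ∞)) (by simp)).differentiable (by simp) x
  have h : ∀ i, fderiv ℝ (pder u i) x = (fderiv ℝ (fderiv ℝ u) x).flip (b2 i) := by
    intro i
    have := hd.hasFDerivAt.clm_apply (hasFDerivAt_const (b2 i) x)
    refine this.fderiv.trans ?_
    simp
  have h2 : minSmoothness ℝ 2 ≤ ((⊤ : ℕ∞) : WithTop ℕ∞) := by
    rw [minSmoothness_of_isRCLikeNormedField]
    exact WithTop.coe_le_coe.2 (le_top : (2 : ℕ∞) ≤ ⊤)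
  rw [h, h, ContinuousLinearMap.flip_apply, ContinuousLinearMap.flip_apply]
  exact (hu.contDiffAt.isSymmSndFDerivAt h2).eq _ _

lemma fderiv_eq_pder {k : ℕ} (u : E2 → Evec k) (x : E2) (a b : ℝ) :
    fderiv ℝ u x (a • b2 0 + b • b2 1) = a • pder u 0 x + b • pder u 1 x := by
  simp [pder]

/-- The stress-energy tensor of `u` contracted with the position vector `x - x₀`. -/
def stressField {k : ℕ} (V : Evec k → ℝ) (ε : ℝ) (u : E2 → Evec k) (x₀ : E2) (i : Fin 2)
    (x : E2) : ℝ :=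
  eDens V ε u x * (x i - x₀ i) -
    ε * ⟪(x 0 - x₀ 0) • pder u 0 x + (x 1 - x₀ 1) • pder u 1 x, pder u i x⟫

lemma contDiff_eDens {k : ℕ} {V : Evec k → ℝ} (hV : ContDiff ℝ (⊤ : ℕ∞) V) (ε : ℝ)
    {u : E2 → Evec k} (hu : ContDiff ℝ (⊤ : ℕ∞) u) : ContDiff ℝ (⊤ : ℕ∞) (eDens V ε u) :=
  (contDiff_const.mul (contDiff_gradSq hu)).add (contDiff_const.mul (hV.comp hu))

lemma contDiff_coord_sub (x₀ : E2) (i : Fin 2) {n : ℕ∞} :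
    ContDiff ℝ n fun x : E2 => x i - x₀ i := by
  fun_prop

lemma contDiff_stressField {k : ℕ} {V : Evec k → ℝ} (hV : ContDiff ℝ (⊤ : ℕ∞) V) (ε : ℝ)
    {u : E2 → Evec k} (hu : ContDiff ℝ (⊤ : ℕ∞) u) (x₀ : E2) (i : Fin 2) :
    ContDiff ℝ (⊤ : ℕ∞) (stressField V ε u x₀ i) :=
  ((contDiff_eDens hV ε hu).mul (contDiff_coord_sub x₀ i)).sub
    (contDiff_const.mul ((((contDiff_coord_sub x₀ 0).smul (contDiff_pder hu 0)).add
      ((contDiff_coord_sub x₀ 1).smul (contDiff_pder hu 1))).inner ℝ (contDiff_pder hu i)))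

lemma fderiv_stressField {k : ℕ} {V : Evec k → ℝ} (hV : ContDiff ℝ (⊤ : ℕ∞) V) (ε : ℝ)
    {u : E2 → Evec k} (hu : ContDiff ℝ (⊤ : ℕ∞) u) (x₀ : E2) (i : Fin 2) (x v : E2) :
    fderiv ℝ (stressField V ε u x₀ i) x v =
      (ε * (⟪pder u 0 x, fderiv ℝ (pder u 0) x v⟫ + ⟪pder u 1 x, fderiv ℝ (pder u 1) x v⟫) +
        ε⁻¹ * ⟪gradient V (u x), fderiv ℝ u x v⟫) * (x i - x₀ i) + eDens V ε u x * v i -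
      ε * (⟪v 0 • pder u 0 x + (x 0 - x₀ 0) • fderiv ℝ (pder u 0) x v + (v 1 • pder u 1 x +
          (x 1 - x₀ 1) • fderiv ℝ (pder u 1) x v), pder u i x⟫ +
        ⟪(x 0 - x₀ 0) • pder u 0 x + (x 1 - x₀ 1) • pder u 1 x, fderiv ℝ (pder u i) x v⟫) := by
  have hp : ∀ j, HasFDerivAt (pder u j) (fderiv ℝ (pder u j) x) x := fun j =>
    ((contDiff_pder hu j).differentiable (by simp) x).hasFDerivAt
  have hud := (hu.differentiable (by simp) x).hasFDerivAt
  have hVd := (hV.differentiable (by simp) (u x)).hasFDerivAt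
  have hy : ∀ j, HasFDerivAt (fun x : E2 => x j - x₀ j)
      (EuclideanSpace.proj j : E2 →L[ℝ] ℝ) x := fun j =>
    ((EuclideanSpace.proj j : E2 →L[ℝ] ℝ).hasFDerivAt).sub_const (x₀ j)
  have hg : ∀ w, ⟪gradient V (u x), w⟫ = fderiv ℝ V (u x) w := fun w =>
    InnerProductSpace.toDual_symm_apply
  have he := ((((hp 0).inner ℝ (hp 0)).add ((hp 1).inner ℝ (hp 1))).const_mul (ε / 2)).add
    ((hVd.comp x hud).const_mul ε⁻¹)
  have hT := (he.mul (hy i)).sub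
    (((((hy 0).smul (hp 0)).add ((hy 1).smul (hp 1))).inner ℝ (hp i)).const_mul ε)
  have hT' := hT.congr_of_eventuallyEq (f₁ := stressField V ε u x₀ i) (.of_forall fun z => by
    simp [stressField, eDens, gradSq, Fin.sum_univ_two])
  rw [hT'.fderiv]
  simp only [hg]
  simp [eDens, gradSq, Fin.sum_univ_two, fderivInnerCLM_apply, inner_add_left,
    real_inner_smul_left, real_inner_comm (pder u 0 x) (fderiv ℝ (pder u 0) x v),
    real_inner_comm (pder u 1 x) (fderiv ℝ (pder u 1) x v)]
  ring

/-- The Pohozaev identity in divergence form. -/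
lemma div_stressField {k : ℕ} {V : Evec k → ℝ} (hV : ContDiff ℝ (⊤ : ℕ∞) V) {ε : ℝ}
    (hε : ε ≠ 0) {u : E2 → Evec k} (hu : ContDiff ℝ (⊤ : ℕ∞) u) (x₀ x : E2)
    (hx : lap u x = (ε ^ 2)⁻¹ • gradient V (u x)) :
    fderiv ℝ (stressField V ε u x₀ 0) x (b2 0) + fderiv ℝ (stressField V ε u x₀ 1) x (b2 1) =
      2 * (ε⁻¹ * V (u x)) := by
  have hgrad : gradient V (u x) =
      ε ^ 2 • (fderiv ℝ (pder u 0) x (b2 0) + fderiv ℝ (pder u 1) x (b2 1)) := by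
    rw [lap, Fin.sum_univ_two] at hx
    rw [hx, smul_smul, mul_inv_cancel₀ (pow_ne_zero 2 hε), one_smul]
  rw [fderiv_stressField hV ε hu, fderiv_stressField hV ε hu, hgrad,
    fderiv_pder_comm hu x 1 0]
  have hb : ∀ i, fderiv ℝ u x (b2 i) = pder u i x := fun _ => rfl
  have hb' : ∀ i j, b2 i j = if j = i then 1 else 0 := fun i j => by simp [b2]
  have hε' : ε⁻¹ * ε ^ 2 = ε := by field_simp
  rw [hb, hb]
  simp only [eDens, gradSq, Fin.sum_univ_two, hb', ← real_inner_self_eq_norm_sq]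
  simp only [inner_add_left, real_inner_smul_left, Fin.isValue, if_true,
    one_ne_zero, zero_ne_one, if_false, ← mul_assoc, hε']
  generalize pder u 0 x = p, pder u 1 x = q, fderiv ℝ (pder u 0) x (b2 0) = A,
    fderiv ℝ (pder u 0) x (b2 1) = B, fderiv ℝ (pder u 1) x (b2 1) = C
  rw [real_inner_comm p A, real_inner_comm p B, real_inner_comm p C, real_inner_comm q A,
    real_inner_comm q B, real_inner_comm q C]
  ring_nf

lemma stressField_circPt {k : ℕ} (V : Evec k → ℝ) (ε : ℝ) (u : E2 → Evec k) (x₀ : E2)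
    (r θ : ℝ) :
    stressField V ε u x₀ 0 (circPt x₀ r θ) * Real.cos θ +
        stressField V ε u x₀ 1 (circPt x₀ r θ) * Real.sin θ =
      r * (eDens V ε u (circPt x₀ r θ) -
        ε * ‖fderiv ℝ u (circPt x₀ r θ) (norv θ)‖ ^ 2) := by
  have h0 : circPt x₀ r θ 0 - x₀ 0 = r * Real.cos θ := by simp [circPt, vec2]
  have h1 : circPt x₀ r θ 1 - x₀ 1 = r * Real.sin θ := by simp [circPt, vec2]
  rw [norv_eq, fderiv_eq_pder, ← real_inner_self_eq_norm_sq]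
  simp only [stressField, h0, h1, inner_add_left, inner_add_right, real_inner_smul_left,
    real_inner_smul_right]
  linear_combination r * eDens V ε u (circPt x₀ r θ) * Real.sin_sq_add_cos_sq θ

lemma hasDerivAt_energy_div_of_contDiff {k : ℕ} {V : Evec k → ℝ}
    (hV : ContDiff ℝ (⊤ : ℕ∞) V) {ε : ℝ} (hε : ε ≠ 0) {u : E2 → Evec k}
    (hu : ContDiff ℝ (⊤ : ℕ∞) u) (x₀ : E2) {r : ℝ} (hr : 0 < r)
    (hpde : ∀ x ∈ ball x₀ r, lap u x = (ε ^ 2)⁻¹ • gradient V (u x)) :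
    HasDerivAt (fun s : ℝ => energy V ε u (ball x₀ s) / s)
      ((1 / r ^ 2) * (∫ x in ball x₀ r, (ε⁻¹ * V (u x) - ε / 2 * gradSq u x)) +
        (1 / r) * ∫ θ in (0 : ℝ)..(2 * Real.pi),
          (ε * ‖fderiv ℝ u (circPt x₀ r θ) (norv θ)‖ ^ 2) * r) r := by
  have he := (contDiff_eDens hV ε hu).continuous
  have hVc : Continuous fun x => 2 * (ε⁻¹ * V (u x)) :=
    continuous_const.mul (continuous_const.mul (hV.continuous.comp hu.continuous))
  have hint : ∀ {f : E2 → ℝ}, Continuous f → IntegrableOn f (ball x₀ r) := fun hf =>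
    (hf.continuousOn.integrableOn_compact (isCompact_closedBall x₀ r)).mono_set
      ball_subset_closedBall
  have hcirc : Continuous fun θ => circPt x₀ r θ :=
    (continuous_circPt x₀).comp (by fun_prop : Continuous fun θ : ℝ => (r, θ))
  have hnor : Continuous fun θ => norv θ := by
    simp only [norv_eq]
    fun_prop
  have hn : Continuous fun θ => ε * ‖fderiv ℝ u (circPt x₀ r θ) (norv θ)‖ ^ 2 :=
    continuous_const.mul ((((hu.continuous_fderiv (by simp)).comp hcirc).clm_apply
      hnor).norm.pow 2)
  have hdiv := integral_divergence_ball x₀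
    ((contDiff_stressField hV ε hu x₀ 0).of_le (by simp))
    ((contDiff_stressField hV ε hu x₀ 1).of_le (by simp)) hr.le
  rw [setIntegral_congr_fun measurableSet_ball
    fun x hx => div_stressField hV hε hu x₀ x (hpde x hx)] at hdiv
  simp only [stressField_circPt] at hdiv
  rw [intervalIntegral.integral_const_mul, intervalIntegral.integral_sub
    (Continuous.intervalIntegrable (u := fun θ => eDens V ε u (circPt x₀ r θ))
      (he.comp hcirc) _ _) (hn.intervalIntegrable _ _)] at hdiv
  have hdisc : ∫ x in ball x₀ r, (ε⁻¹ * V (u x) - ε / 2 * gradSq u x) =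
      (∫ x in ball x₀ r, 2 * (ε⁻¹ * V (u x))) - ∫ x in ball x₀ r, eDens V ε u x := by
    rw [← integral_sub (hint hVc) (hint he)]
    congr 1
    funext x
    simp only [eDens]
    ring
  have hder := (hasDerivAt_integral_ball x₀ he hr).div (hasDerivAt_id r) hr.ne'
  refine hder.congr_deriv ?_
  rw [hdisc, hdiv, intervalIntegral.integral_mul_const]
  simp only [id]
  field_simp
  ring

/-- A map smooth on an open set containing a closed ball agrees near it with a smooth map. -/
lemma exists_contDiff_eqOn_ball {k : ℕ} {Ω : Set E2} (hΩ : IsOpen Ω) {u : E2 → Evec k}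
    (hu : ContDiffOn ℝ (⊤ : ℕ∞) u Ω) {x₀ : E2} {R : ℝ} (hball : ball x₀ R ⊆ Ω)
    {r : ℝ} (hr0 : 0 < r) (hr : r < R) :
    ∃ w : E2 → Evec k, ContDiff ℝ (⊤ : ℕ∞) w ∧ Set.EqOn w u (ball x₀ r) := by
  obtain ⟨s, hrs, hsR⟩ := exists_between hr
  let φ : ContDiffBump x₀ := ⟨r, s, hr0, hrs⟩
  refine ⟨fun x => φ x • u x, ?_, fun x hx => ?_⟩
  · rw [contDiff_iff_contDiffAt]
    intro x
    by_cases hx : x ∈ closedBall x₀ s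
    · have hxΩ : x ∈ Ω := hball (closedBall_subset_ball hsR hx)
      exact φ.contDiff.contDiffAt.smul (hu.contDiffAt (hΩ.mem_nhds hxΩ))
    · have hz : (fun x => φ x • u x) =ᶠ[𝓝 x] fun _ => 0 := by
        filter_upwards [isClosed_closedBall.isOpen_compl.mem_nhds hx] with y hy
        have hy' : s < dist y x₀ := by simpa using hy
        rw [φ.zero_of_le_dist hy'.le, zero_smul]
      exact contDiffAt_const.congr_of_eventuallyEq hz
  · simp only
    rw [φ.one_of_mem_closedBall (ball_subset_closedBall hx), one_smul]

/-- energy–discrepancy identity. For a solution on `Ω` and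
`0 < r < dist(x₀,∂Ω)`, the function `r ↦ E_ε(u_ε, D(x₀,r))/r` is
differentiable with derivative `(1/r²)∫_{D(x₀,r)} ξ_ε(u_ε) +
(1/r)∫_{∂D(x₀,r)} ε|∂u/∂ν|² dℓ`, where `ξ_ε(u) = ε⁻¹V(u) − (ε/2)|∇u|²` is the
discrepancy and the boundary circle is parametrized by arclength `dℓ = r dθ`. -/
theorem statement_14 (k : ℕ) (hk : 1 ≤ k) (V : Evec k → ℝ) (hV : IsMultiWell V)
    (Ω : Set E2) (hΩo : IsOpen Ω) (hΩb : IsBounded Ω)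
    (ε : ℝ) (hε : 0 < ε)
    (u : E2 → Evec k) (hu : IsSolution V ε Ω u)
    (x₀ : E2) (hx₀ : x₀ ∈ Ω)
    (r : ℝ) (hr0 : 0 < r) (hr : r < infDist x₀ Ωᶜ) :
    HasDerivAt (fun s : ℝ => energy V ε u (ball x₀ s) / s)
      ((1 / r ^ 2) * (∫ x in ball x₀ r, (ε⁻¹ * V (u x) - ε / 2 * gradSq u x)) +
        (1 / r) * ∫ θ in (0 : ℝ)..(2 * Real.pi),
          (ε * ‖fderiv ℝ u (circPt x₀ r θ) (norv θ)‖ ^ 2) * r) r := by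
  obtain ⟨r₁, hr₁, hr₁R⟩ := exists_between hr
  have hball : ball x₀ (infDist x₀ Ωᶜ) ⊆ Ω := ball_infDist_compl_subset
  obtain ⟨w, hw, hwu⟩ := exists_contDiff_eqOn_ball hΩo hu.1 hball (hr0.trans hr₁) hr₁R
  have hev : ∀ x ∈ ball x₀ r₁, w =ᶠ[𝓝 x] u := fun x hx =>
    hwu.eventuallyEq_of_mem (isOpen_ball.mem_nhds hx)
  have hfd : Set.EqOn (fderiv ℝ w) (fderiv ℝ u) (ball x₀ r₁) := fun x hx => (hev x hx).fderiv_eq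
  have hpd : ∀ i, Set.EqOn (pder w i) (pder u i) (ball x₀ r₁) := fun i x hx => by
    simp only [pder, hfd hx]
  have hgr : Set.EqOn (gradSq w) (gradSq u) (ball x₀ r₁) := fun x hx => by
    simp only [gradSq, hpd _ hx]
  have hlap : Set.EqOn (lap w) (lap u) (ball x₀ r₁) := fun x hx => by
    simp only [lap, ((hpd _).eventuallyEq_of_mem (isOpen_ball.mem_nhds hx)).fderiv_eq]
  have hsub : ball x₀ r ⊆ ball x₀ r₁ := ball_subset_ball hr₁.le
  have main := hasDerivAt_energy_div_of_contDiff hV.smooth hε.ne' hw x₀ hr0 fun x hx => by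
    rw [hlap (hsub hx), hwu (hsub hx)]
    exact hu.2 x (hball (ball_subset_ball hr₁R.le (hsub hx)))
  have hdisc : ∫ x in ball x₀ r, (ε⁻¹ * V (w x) - ε / 2 * gradSq w x) =
      ∫ x in ball x₀ r, (ε⁻¹ * V (u x) - ε / 2 * gradSq u x) :=
    setIntegral_congr_fun measurableSet_ball fun x hx => by
      simp only [hwu (hsub hx), hgr (hsub hx)]
  have hcirc : ∀ θ, fderiv ℝ w (circPt x₀ r θ) = fderiv ℝ u (circPt x₀ r θ) := fun θ => by
    refine hfd ?_
    rw [mem_ball, dist_circPt, abs_of_pos hr0]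
    exact hr₁
  simp only [hdisc, hcirc] at main
  refine main.congr_of_eventuallyEq ?_
  filter_upwards [gt_mem_nhds hr₁] with s hs
  congr 1
  refine setIntegral_congr_fun measurableSet_ball fun x hx => ?_
  have hx' := ball_subset_ball hs.le hx
  simp only [eDens, hwu hx', hgr hx']
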